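/- Assume d_x ≥ d_z³ with d_z ≥ 1. Let B_1,…,B_{d_z} ∈ ℝ^{d_x×d_x} be symmetric matrices and let x₀ ∈ ℝ^{d_x}. Then for (Lebesgue-)almost every matrix A ∈ ℝ^{d_z×d_x} there exist a twice continuously differentiable coordinate-wise additive map f : ℝ^{d_z} → ℝ^{d_x} and a twice continuously differentiable map g : ℝ^{d_x} → ℝ^{d_z} such that g(f(z)) = z for all z ∈ ℝ^{d_z}, f(0) = x₀, Dg(x₀) = A, and D²g_l(x₀) = B_l for every l ∈ {1,…,d_z}. -/

import Mathlib

open Matrix MeasureTheory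

/-- Jacobian matrix of `f : ℝ^n → ℝ^m` at `z`, of shape `m × n`. -/
noncomputable def jacobian {n m : ℕ} (f : (Fin n → ℝ) → (Fin m → ℝ)) (z : Fin n → ℝ) :
    Matrix (Fin m) (Fin n) ℝ :=
  Matrix.of fun i j => fderiv ℝ f z (Pi.single j 1) i

/-- Hessian matrix of a scalar function `f : ℝ^n → ℝ` at `z`. -/
noncomputable def hessian {n : ℕ} (f : (Fin n → ℝ) → ℝ) (z : Fin n → ℝ) :
    Matrix (Fin n) (Fin n) ℝ :=
  Matrix.of fun i j => fderiv ℝ (fun y => fderiv ℝ f y (Pi.single j 1)) z (Pi.single i 1)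

/-- `f : ℝ^{d₁} → ℝ^{d₂}` is coordinate-wise additive: `f(z) = Σ_i f_i(z_i)`. -/
def CoordAdditive {d₁ d₂ : ℕ} (f : (Fin d₁ → ℝ) → (Fin d₂ → ℝ)) : Prop :=
  ∃ F : Fin d₁ → ℝ → (Fin d₂ → ℝ), ∀ z, f z = ∑ i, F i (z i)

lemma aux_det {m n : ℕ} (P : Matrix (Fin n) (Fin m) ℝ) (L : Matrix (Fin m) (Fin n) ℝ)
    (hL : L * P = 1) :
    ∀ᵐ A ∂(volume : Measure (Fin m → Fin n → ℝ)), (Matrix.of A * P).det ≠ 0 := by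
  let M : ℝ →ₗ[ℝ] (Fin m → Fin n → ℝ) := LinearMap.toSpanSingleton ℝ _ (fun i j => L i j)
  have hc : Continuous (fun A : Fin m → Fin n → ℝ => (Matrix.of A * P).det) := by
    apply Continuous.matrix_det
    apply Continuous.matrix_mul _ continuous_const
    exact continuous_id
  have hs : MeasurableSet {A : Fin m → Fin n → ℝ | (Matrix.of A * P).det ≠ 0} :=
    (isOpen_ne_fun hc continuous_const).measurableSet
  refine ae_mem_of_ae_add_linearMap_mem M volume volume hs ?_
  intro A
  have hp := Matrix.charpoly_monic (-(Matrix.of A * P))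
  have hfin : {t : ℝ | (-(Matrix.of A * P)).charpoly.IsRoot t}.Finite :=
    Polynomial.finite_setOfPred_isRoot hp.ne_zero
  have h0 := hfin.measure_zero (volume : Measure ℝ)
  rw [ae_iff]
  refine measure_mono_null ?_ h0
  intro t ht
  replace ht : (Matrix.of (A + M t) * P).det = 0 := not_not.1 ht
  change (-(Matrix.of A * P)).charpoly.IsRoot t
  rw [Polynomial.IsRoot, Matrix.eval_charpoly, ← ht]
  congr 1
  have : Matrix.of (A + M t) = Matrix.of A + t • L := by
    ext i j; simp [M, LinearMap.toSpanSingleton_apply]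
  rw [this, Matrix.add_mul, Matrix.smul_mul, hL, sub_neg_eq_add, add_comm]
  congr 1
  ext i j; simp [Matrix.scalar_apply, Matrix.diagonal_apply, Matrix.one_apply]

lemma aux_step {m n k : ℕ} (hk : k * m ^ 2 + m ≤ n)
    (B : Fin m → Matrix (Fin n) (Fin n) ℝ) (P : ℕ → Matrix (Fin n) (Fin m) ℝ) :
    ∃ (Q : Matrix (Fin n) (Fin m) ℝ) (L : Matrix (Fin m) (Fin n) ℝ), L * Q = 1 ∧
      ∀ i < k, ∀ l, (P i)ᵀ * B l * Q = 0 := by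
  let T : (Fin n → ℝ) →ₗ[ℝ] (Fin k → Fin m → Fin m → ℝ) :=
    LinearMap.pi fun i => LinearMap.pi fun l => Matrix.mulVecLin ((P i)ᵀ * B l)
  have h1 := T.finrank_range_add_finrank_ker
  have h2 : Module.finrank ℝ (LinearMap.range T) ≤ k * m ^ 2 := by
    refine (Submodule.finrank_le _).trans ?_
    simp [Module.finrank_pi_fintype, sq]
  have h3 : m ≤ Module.finrank ℝ (LinearMap.ker T) := by
    simp at h1
    omega
  obtain ⟨u, hu⟩ := exists_linearIndependent_of_le_finrank h3
  have hu' : LinearIndependent ℝ (fun i => (u i : Fin n → ℝ)) :=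
    hu.map' (LinearMap.ker T).subtype (Submodule.ker_subtype _)
  let Q : Matrix (Fin n) (Fin m) ℝ := Matrix.of fun a i => (u i : Fin n → ℝ) a
  have hQ : Function.Injective Q.mulVec := by
    rw [Matrix.mulVec_injective_iff]
    exact hu'
  obtain ⟨L, hL⟩ := LinearMap.exists_leftInverse_of_injective (Matrix.toLin' Q)
    (LinearMap.ker_eq_bot.2 hQ)
  refine ⟨Q, LinearMap.toMatrix' L, ?_, ?_⟩
  · have := congrArg LinearMap.toMatrix' hL
    rwa [LinearMap.toMatrix'_comp, LinearMap.toMatrix'_toLin', LinearMap.toMatrix'_id] at this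
  intro i hi l
  ext a b
  have := (u b).2
  rw [LinearMap.mem_ker] at this
  have := congrFun (congrFun (congrFun this ⟨i, hi⟩) l) a
  exact this

lemma aux_family {m n : ℕ} (hn : m ^ 3 ≤ n)
    (B : Fin m → Matrix (Fin n) (Fin n) ℝ) (hB : ∀ l, (B l)ᵀ = B l) (k : ℕ) (hk : k ≤ m) :
    ∃ (P : ℕ → Matrix (Fin n) (Fin m) ℝ), (∀ i < k, ∃ L : Matrix (Fin m) (Fin n) ℝ, L * P i = 1) ∧
      ∀ i < k, ∀ j < k, i ≠ j → ∀ l, (P i)ᵀ * B l * P j = 0 := by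
  induction k with
  | zero => exact ⟨fun _ => 0, by simp, by simp⟩
  | succ k ih =>
    obtain ⟨P, h1, h2⟩ := ih (by omega)
    have hk' : k * m ^ 2 + m ≤ n := by
      refine le_trans ?_ hn
      have : (k + 1) * m ^ 2 ≤ m * m ^ 2 := Nat.mul_le_mul_right _ hk
      nlinarith
    obtain ⟨Q, L, hL, hQ⟩ := aux_step hk' B P
    have hQ' : ∀ i < k, ∀ l, Qᵀ * B l * P i = 0 := by
      intro i hi l
      have := congrArg Matrix.transpose (hQ i hi l)
      simpa [Matrix.transpose_mul, hB, Matrix.mul_assoc] using this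
    refine ⟨fun i => if i = k then Q else P i, ?_, ?_⟩
    · intro i hi
      by_cases h : i = k
      · simp only [h, if_true]; exact ⟨L, hL⟩
      · simp only [h, if_false]; exact h1 i (by omega)
    · intro i hi j hj hij l
      by_cases h : i = k
      · have hj' : j ≠ k := by omega
        simp only [h, hj', if_true, if_false]; exact hQ' j (by omega) l
      · by_cases hj' : j = k
        · simp only [h, hj', if_true, if_false]; exact hQ i (by omega) l
        · simp only [h, hj', if_false]; exact h2 i (by omega) j (by omega) hij l

lemma aux_ae {m n : ℕ} (hn : m ^ 3 ≤ n)
    (B : Fin m → Matrix (Fin n) (Fin n) ℝ) (hB : ∀ l, (B l)ᵀ = B l) :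
    ∀ᵐ A ∂(volume : Measure (Fin m → Fin n → ℝ)),
      ∃ v : Fin m → Fin n → ℝ, (∀ i, Matrix.of A *ᵥ v i = Pi.single i 1) ∧
        ∀ i j, i ≠ j → ∀ l, v i ⬝ᵥ (B l *ᵥ v j) = 0 := by
  obtain ⟨P, h1, h2⟩ := aux_family hn B hB m le_rfl
  have : ∀ i : Fin m, ∀ᵐ A ∂(volume : Measure (Fin m → Fin n → ℝ)),
      (Matrix.of A * P i).det ≠ 0 := fun i => by
    obtain ⟨L, hL⟩ := h1 i i.2
    exact aux_det _ L hL
  rw [← ae_all_iff] at this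
  filter_upwards [this] with A hA
  refine ⟨fun i => P i *ᵥ ((Matrix.of A * P i)⁻¹ *ᵥ Pi.single i 1), ?_, ?_⟩
  · intro i
    rw [Matrix.mulVec_mulVec, Matrix.mulVec_mulVec, Matrix.mul_nonsing_inv _ (hA i).isUnit,
      Matrix.one_mulVec]
  · intro i j hij l
    have := h2 i i.2 j j.2 (by simpa [Fin.ext_iff] using hij) l
    beta_reduce
    rw [Matrix.mulVec_mulVec _ (B l), ← Matrix.vecMul_transpose (P i), ← Matrix.dotProduct_mulVec,
      Matrix.mulVec_mulVec, ← Matrix.mul_assoc, this]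
    simp

lemma aux_core {m : ℕ} (b : Fin m → Fin m → ℝ) :
    ∃ (φ : ℝ → ℝ) (Φ Ψ : (Fin m → ℝ) → (Fin m → ℝ)), ContDiff ℝ 2 Φ ∧ ContDiff ℝ 2 Ψ ∧
      (∀ z, Ψ (Φ z) = z) ∧ (∀ z, Φ z = z - ∑ i, φ (z i) • b i) ∧ Φ 0 = 0 ∧
      fderiv ℝ Ψ 0 = ContinuousLinearMap.id ℝ _ ∧
      ∀ s t, fderiv ℝ (fderiv ℝ Ψ) 0 s t = ∑ i, (s i * t i) • b i := by
  let p : Fin m → ((Fin m → ℝ) →L[ℝ] ℝ) := fun i => ContinuousLinearMap.proj i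
  let K : ℝ := ∑ i, ‖(p i).smulRight (b i)‖
  have hK : 0 ≤ K := Finset.sum_nonneg fun i _ => norm_nonneg _
  let ε : ℝ := (2 * (K + 1))⁻¹
  have hε : 0 < ε := by positivity
  have hεK : ε * K ≤ 1 / 2 := by
    have h : ε * (2 * (K + 1)) = 1 := inv_mul_cancel₀ (by positivity)
    nlinarith
  let φ : ℝ → ℝ := fun t => ε ^ 2 * (1 - Real.cos (t / ε))
  have hφ : ∀ t, HasDerivAt φ (ε * Real.sin (t / ε)) t := by
    intro t
    have h := (((hasDerivAt_id t).div_const ε).cos.const_sub 1).const_mul (ε ^ 2)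
    refine h.congr_deriv ?_
    simp only [id]
    field_simp
  have hφ2 : HasDerivAt (fun t => ε * Real.sin (t / ε)) 1 0 := by
    have h := (((hasDerivAt_id (0:ℝ)).div_const ε).sin).const_mul ε
    refine h.congr_deriv ?_
    simp
    field_simp
  let u : (Fin m → ℝ) → (Fin m → ℝ) := fun z => ∑ i, φ (z i) • b i
  let du : (Fin m → ℝ) → ((Fin m → ℝ) →L[ℝ] (Fin m → ℝ)) :=
    fun z => ∑ i, (ε * Real.sin (z i / ε)) • (p i).smulRight (b i)
  have hu : ∀ z, HasFDerivAt u (du z) z := by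
    intro z
    refine HasFDerivAt.fun_sum fun i _ => ?_
    have h1 : HasFDerivAt (fun z : Fin m → ℝ => φ (z i)) ((ε * Real.sin (z i / ε)) • p i) z :=
      HasDerivAt.comp_hasFDerivAt (h₂ := φ) z (hφ (z i)) (p i).hasFDerivAt
    have h2 := h1.smul_const (b i)
    convert h2 using 1
    ext w; simp [mul_assoc]
  have hub : ∀ z, ‖du z‖ ≤ 1 / 2 := by
    intro z
    refine le_trans ?_ hεK
    refine (norm_sum_le _ _).trans ?_
    rw [Finset.mul_sum]
    refine Finset.sum_le_sum fun i _ => ?_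
    rw [norm_smul]
    refine mul_le_mul_of_nonneg_right ?_ (norm_nonneg _)
    rw [norm_mul, Real.norm_eq_abs, Real.norm_eq_abs, abs_of_pos hε]
    exact mul_le_of_le_one_right hε.le (Real.abs_sin_le_one _)
  have huc : ContDiff ℝ 2 u := by
    refine ContDiff.sum fun i _ => ContDiff.fun_smul ?_ contDiff_const
    have : ContDiff ℝ 2 φ :=
      contDiff_const.mul (contDiff_const.sub (Real.contDiff_cos.comp (contDiff_id.div_const ε)))
    exact this.comp (p i).contDiff
  have huL : ∀ x y, ‖u x - u y‖ ≤ (1 / 2) * ‖x - y‖ := by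
    intro x y
    exact Convex.norm_image_sub_le_of_norm_hasFDerivWithin_le (s := Set.univ)
      (fun z _ => (hu z).hasFDerivWithinAt) (fun z _ => hub z) convex_univ (Set.mem_univ _)
      (Set.mem_univ _)
  let Φ : (Fin m → ℝ) → (Fin m → ℝ) := fun z => z - u z
  have hΦ : ∀ z, HasFDerivAt Φ (1 - du z) z := fun z => (hasFDerivAt_id z).sub (hu z)
  have hΦc : ContDiff ℝ 2 Φ := contDiff_id.sub huc
  have happ : ApproximatesLinearOn Φ
      ((ContinuousLinearEquiv.refl ℝ (Fin m → ℝ) : (Fin m → ℝ) ≃L[ℝ] (Fin m → ℝ)) :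
        (Fin m → ℝ) →L[ℝ] (Fin m → ℝ)) Set.univ (1/2) := by
    intro x _ y _
    have : Φ x - Φ y - (x - y) = -(u x - u y) := by simp only [Φ]; abel
    simp only [ContinuousLinearEquiv.coe_refl, ContinuousLinearMap.coe_id', id]
    rw [this, norm_neg]
    simpa using huL x y
  have hcc : Subsingleton (Fin m → ℝ) ∨ (1/2 : NNReal) <
      ‖((ContinuousLinearEquiv.refl ℝ (Fin m → ℝ)).symm :
        (Fin m → ℝ) →L[ℝ] (Fin m → ℝ))‖₊⁻¹ := by
    rcases subsingleton_or_nontrivial (Fin m → ℝ) with h | h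
    · exact Or.inl h
    · right
      have : ‖((ContinuousLinearEquiv.refl ℝ (Fin m → ℝ)).symm :
        (Fin m → ℝ) →L[ℝ] (Fin m → ℝ))‖₊ = 1 := by
        rw [ContinuousLinearEquiv.refl_symm, ContinuousLinearEquiv.coe_refl]
        exact ContinuousLinearMap.nnnorm_id
      rw [this, inv_one]
      exact NNReal.half_lt_self one_ne_zero
  let H := happ.toHomeomorph Φ hcc
  have hH : ∀ z, H z = Φ z := fun z => rfl
  let Ψ := H.symm
  have hΨc : ContDiff ℝ 2 Ψ := by
    refine H.contDiff_symm (f₀' := fun z => ContinuousLinearEquiv.ofUnit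
      (Units.oneSub (du z) ((hub z).trans_lt (by norm_num)))) ?_ hΦc
    intro z
    exact hΦ z
  have hΨΦ : ∀ z, Ψ (Φ z) = z := fun z => H.symm_apply_apply z
  have hΦ0 : Φ 0 = 0 := by simp [Φ, u, φ]
  have hu0 : du 0 = 0 := by simp [du]
  have hdΨ : Differentiable ℝ Ψ := hΨc.differentiable (by norm_num)
  have hcomp : ∀ z, (fderiv ℝ Ψ (Φ z)).comp (1 - du z) = 1 := by
    intro z
    have h1 := (hdΨ (Φ z)).hasFDerivAt.comp z (hΦ z)
    have h2 : (Ψ ∘ Φ) = id := funext hΨΦ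
    rw [h2] at h1
    exact h1.unique (hasFDerivAt_id z)
  have hΨ0 : fderiv ℝ Ψ 0 = 1 := by
    have := hcomp 0
    rw [hΦ0, hu0, sub_zero] at this
    exact this
  have hdd : HasFDerivAt (fderiv ℝ Ψ) (fderiv ℝ (fderiv ℝ Ψ) 0) 0 := by
    have : ContDiff ℝ 1 (fderiv ℝ Ψ) := hΨc.fderiv_right (by norm_num)
    exact (this.differentiable (by norm_num) 0).hasFDerivAt
  let ddu : (Fin m → ℝ) →L[ℝ] ((Fin m → ℝ) →L[ℝ] (Fin m → ℝ)) :=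
    ∑ i, (p i).smulRight ((p i).smulRight (b i))
  have hddu : HasFDerivAt du ddu 0 := by
    refine HasFDerivAt.fun_sum fun i _ => ?_
    have h1 : HasFDerivAt (fun z : Fin m → ℝ => ε * Real.sin (z i / ε)) ((1:ℝ) • p i) 0 :=
      HasDerivAt.comp_hasFDerivAt (h₂ := fun t => ε * Real.sin (t / ε)) 0 (by simpa using hφ2)
        (p i).hasFDerivAt
    rw [one_smul] at h1
    exact h1.smul_const ((p i).smulRight (b i))
  refine ⟨φ, Φ, Ψ, hΦc, hΨc, hΨΦ, fun z => rfl, hΦ0, hΨ0, ?_⟩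
  intro s t
  have h1 : HasFDerivAt (fun z => fderiv ℝ Ψ (Φ z)) ((fderiv ℝ (fderiv ℝ Ψ) 0).comp (1 - du 0)) 0 := by
    have := hΦ 0
    refine HasFDerivAt.comp (g := fderiv ℝ Ψ) 0 ?_ this
    rw [hΦ0]; exact hdd
  have h2 : HasFDerivAt (fun z => 1 - du z) (-ddu) 0 := hddu.const_sub 1
  have h3 := h1.clm_comp h2
  have h4 : (fun z => (fderiv ℝ Ψ (Φ z)).comp (1 - du z)) = fun _ => 1 := funext hcomp
  rw [h4] at h3
  have h5 := h3.unique (hasFDerivAt_const _ _)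
  have h6 := congrArg (fun T => T s t) h5
  simp [hΦ0, hu0, hΨ0, ddu, p] at h6
  rw [neg_add_eq_zero] at h6
  rw [← h6]
  simp [mul_smul]

lemma aux_hess {n m : ℕ} (g : (Fin n → ℝ) → (Fin m → ℝ)) (x₀ : Fin n → ℝ)
    (G : (Fin n → ℝ) → ((Fin n → ℝ) →L[ℝ] (Fin m → ℝ)))
    (GG : (Fin n → ℝ) →L[ℝ] ((Fin n → ℝ) →L[ℝ] (Fin m → ℝ)))
    (h1 : ∀ x, HasFDerivAt g (G x) x) (h2 : HasFDerivAt G GG x₀) (l : Fin m) (i j : Fin n) :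
    hessian (fun x => g x l) x₀ i j = GG (Pi.single i 1) (Pi.single j 1) l := by
  have h3 : ∀ x, fderiv ℝ (fun x => g x l) x (Pi.single j 1) = G x (Pi.single j 1) l := by
    intro x
    have := (hasFDerivAt_pi'.1 (h1 x)) l
    rw [this.fderiv]; rfl
  unfold hessian
  simp only [Matrix.of_apply, h3]
  have h4 : HasFDerivAt (fun x => G x (Pi.single j 1) l)
      (((ContinuousLinearMap.proj l : (Fin m → ℝ) →L[ℝ] ℝ).comp
        (ContinuousLinearMap.apply ℝ (Fin m → ℝ) (Pi.single j 1 : Fin n → ℝ))).comp GG) x₀ :=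
    ((ContinuousLinearMap.proj l : (Fin m → ℝ) →L[ℝ] ℝ).comp
        (ContinuousLinearMap.apply ℝ (Fin m → ℝ) (Pi.single j 1 : Fin n → ℝ))).hasFDerivAt.comp x₀ h2
  rw [h4.fderiv]; rfl

lemma aux_abstract {m n : ℕ} (hm : 1 ≤ m) (x₀ : Fin n → ℝ) (A : (Fin n → ℝ) →L[ℝ] (Fin m → ℝ))
    (v : Fin m → Fin n → ℝ) (hv : ∀ i, A (v i) = Pi.single i 1)
    (Q : (Fin n → ℝ) →L[ℝ] ((Fin n → ℝ) →L[ℝ] (Fin m → ℝ))) (hQ : ∀ x y, Q x y = Q y x)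
    (hQv : ∀ i j, i ≠ j → Q (v i) (v j) = 0) :
    ∃ (f : (Fin m → ℝ) → (Fin n → ℝ)) (g : (Fin n → ℝ) → (Fin m → ℝ)),
        ContDiff ℝ 2 f ∧ ContDiff ℝ 2 g ∧ CoordAdditive f ∧
        (∀ z, g (f z) = z) ∧ f 0 = x₀ ∧ fderiv ℝ g x₀ = A ∧
        ∀ l i j, hessian (fun x => g x l) x₀ i j = Q (Pi.single i 1) (Pi.single j 1) l := by
  obtain ⟨φ, Φ, Ψ, hΦc, hΨc, hΨΦ, hΦ, hΦ0, hΨ1, hΨ2⟩ := aux_core (fun i => Q (v i) (v i))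
  let V : (Fin m → ℝ) →L[ℝ] (Fin n → ℝ) :=
    ∑ i, (ContinuousLinearMap.proj i : (Fin m → ℝ) →L[ℝ] ℝ).smulRight (v i)
  have hV : ∀ z, V z = ∑ i, z i • v i := by intro z; simp [V]
  have hAV : ∀ z, A (V z) = z := by
    intro z
    rw [hV, map_sum]
    simp only [map_smul, hv]
    ext k; simp [Finset.sum_apply, Pi.single_apply]
  have hQV : ∀ s t, Q (V s) (V t) = ∑ i, (s i * t i) • Q (v i) (v i) := by
    intro s t
    rw [hV, hV]
    simp only [map_sum, map_smul, _root_.sum_apply, _root_.smul_apply]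
    refine Finset.sum_congr rfl fun i _ => ?_
    rw [Finset.sum_eq_single i]
    · rw [smul_smul, mul_comm]
    · intro j _ hj; rw [hQv _ _ (by tauto)]; simp
    · simp
  let VA := V.comp A
  let C : (Fin n → ℝ) →L[ℝ] ((Fin n → ℝ) →L[ℝ] (Fin m → ℝ)) := Q - Q.bilinearComp VA VA
  have hC : ∀ x y, C x y = Q x y - Q (V (A x)) (V (A y)) := by intro x y; simp [C, VA]
  have hCs : ∀ x y, C x y = C y x := by intro x y; rw [hC, hC, hQ x y, hQ (V (A x))]
  have hΨ0 : Ψ 0 = 0 := by have := hΨΦ 0; rwa [hΦ0] at this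
  let g : (Fin n → ℝ) → (Fin m → ℝ) := fun x => Ψ (A (x - x₀)) + (1/2 : ℝ) • C (x - x₀) (x - x₀)
  let G : (Fin n → ℝ) → ((Fin n → ℝ) →L[ℝ] (Fin m → ℝ)) :=
    fun x => (fderiv ℝ Ψ (A (x - x₀))).comp A + C (x - x₀)
  have hsub : ∀ x, HasFDerivAt (fun x : Fin n → ℝ => x - x₀) (1 : (Fin n → ℝ) →L[ℝ] (Fin n → ℝ)) x :=
    fun x => (hasFDerivAt_id x).sub_const x₀
  have hAs : ∀ x, HasFDerivAt (fun x : Fin n → ℝ => A (x - x₀)) A x :=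
    fun x => A.hasFDerivAt.comp x (hsub x)
  have hg : ∀ x, HasFDerivAt g (G x) x := by
    intro x
    refine HasFDerivAt.add ?_ ?_
    · exact ((hΨc.differentiable (by norm_num)) _).hasFDerivAt.comp x (hAs x)
    · have h1 : HasFDerivAt (fun x => C (x - x₀)) C x := C.hasFDerivAt.comp x (hsub x)
      have h2 := (h1.clm_apply (hsub x)).const_smul (1/2 : ℝ)
      refine h2.congr_fderiv ?_
      ext w k
      have h3 := congrFun (hCs w (x - x₀)) k
      have h4 : (1/2 : ℝ) * (C (x - x₀) w k + C w (x - x₀) k) = C (x - x₀) w k := by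
        rw [h3]; ring
      exact h4
  have hdd : ∀ y, HasFDerivAt (fderiv ℝ Ψ) (fderiv ℝ (fderiv ℝ Ψ) y) y := by
    have : ContDiff ℝ 1 (fderiv ℝ Ψ) := hΨc.fderiv_right (by norm_num)
    exact fun y => (this.differentiable (by norm_num) y).hasFDerivAt
  have hG : HasFDerivAt G Q x₀ := by
    have h1 : HasFDerivAt (fun x => fderiv ℝ Ψ (A (x - x₀)))
        ((fderiv ℝ (fderiv ℝ Ψ) (A (x₀ - x₀))).comp A) x₀ := (hdd _).comp x₀ (hAs x₀)
    have h2 := h1.clm_comp (hasFDerivAt_const A x₀)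
    have h3 : HasFDerivAt (fun x => C (x - x₀)) C x₀ := C.hasFDerivAt.comp x₀ (hsub x₀)
    refine (h2.add h3).congr_fderiv ?_
    ext1 a
    ext1 b
    simp [hC, hΨ2, hQV]
  refine ⟨fun z => x₀ + V (Φ z), g, ?_, ?_, ?_, ?_, ?_, ?_, ?_⟩
  · exact contDiff_const.add (V.contDiff.comp hΦc)
  · have hs : ContDiff ℝ 2 (fun x : Fin n → ℝ => x - x₀) := contDiff_id.sub contDiff_const
    refine ContDiff.add (hΨc.comp (A.contDiff.comp hs)) (ContDiff.const_smul _ ?_)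
    exact (C.contDiff.comp hs).clm_apply hs
  · rcases m with _ | m
    · omega
    · refine ⟨fun i t => (if i = 0 then x₀ else 0) + t • v i - φ t • V (Q (v i) (v i)), ?_⟩
      intro z
      simp only [hΦ, map_sub, map_sum, map_smul, Finset.sum_sub_distrib, Finset.sum_add_distrib]
      rw [hV z]
      simp
      try abel
  · intro z
    simp only [g, add_sub_cancel_left, hC, hAV, hΨΦ, sub_self, smul_zero, add_zero]
  · simp [hΦ0]
  · rw [(hg x₀).fderiv]
    simp only [G, sub_self, map_zero, hΨ1, add_zero]
    ext; simp
  · intro l i j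
    exact aux_hess g x₀ G Q hg hG l i j

/-- Assume `d_x ≥ d_z³`, `d_z ≥ 1`. Given symmetric matrices `B₁,…,B_{d_z}` and a point `x₀`,
for Lebesgue-almost every `A ∈ ℝ^{d_z × d_x}` there is a C² coordinate-wise additive map
`f : ℝ^{d_z} → ℝ^{d_x}` with a C² left inverse `g`, such that `f(0) = x₀`, `Dg(x₀) = A` and
`D²g_l(x₀) = B_l` for all `l`. -/
theorem jacobian_and_hessian_of_left_inverse_unconstrained (d_z d_x : ℕ)
    (hdz : 1 ≤ d_z) (hdx : d_z ^ 3 ≤ d_x)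
    (B : Fin d_z → Matrix (Fin d_x) (Fin d_x) ℝ) (hB : ∀ l, (B l)ᵀ = B l)
    (x₀ : Fin d_x → ℝ) :
    ∀ᵐ A ∂(volume : Measure (Fin d_z → Fin d_x → ℝ)),
      ∃ (f : (Fin d_z → ℝ) → (Fin d_x → ℝ)) (g : (Fin d_x → ℝ) → (Fin d_z → ℝ)),
        ContDiff ℝ 2 f ∧ ContDiff ℝ 2 g ∧ CoordAdditive f ∧
        (∀ z, g (f z) = z) ∧
        f 0 = x₀ ∧
        jacobian g x₀ = Matrix.of A ∧
        ∀ l : Fin d_z, hessian (fun x => g x l) x₀ = B l := by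
  filter_upwards [aux_ae hdx B hB] with A ⟨v, hv, hvB⟩
  let b : (Fin d_x → ℝ) →ₗ[ℝ] (Fin d_x → ℝ) →ₗ[ℝ] (Fin d_z → ℝ) :=
    LinearMap.mk₂ ℝ (fun x y l => x ⬝ᵥ (B l *ᵥ y))
      (by intros; ext l; simp [add_dotProduct])
      (by intros; ext l; simp)
      (by intros; ext l; simp [Matrix.mulVec_add])
      (by intros; ext l; simp [Matrix.mulVec_smul])
  let Q := LinearMap.toContinuousBilinearMap b
  have hQ : ∀ x y l, Q x y l = x ⬝ᵥ (B l *ᵥ y) := fun x y l => rfl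
  obtain ⟨f, g, h1, h2, h3, h4, h5, h6, h7⟩ := aux_abstract hdz x₀
    (LinearMap.toContinuousLinearMap (Matrix.mulVecLin (Matrix.of A))) v hv Q
    (by
      intro x y
      ext l
      rw [hQ, hQ, Matrix.dotProduct_mulVec, dotProduct_comm, ← Matrix.mulVec_transpose, hB])
    (by
      intro i j hij
      ext l
      rw [hQ, hvB i j hij]; rfl)
  refine ⟨f, g, h1, h2, h3, h4, h5, ?_, ?_⟩
  · ext i j
    simp [jacobian, h6]
  · intro l
    ext i j
    rw [h7, hQ]
    simp
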